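/- (Theorem 1, coefficient form.) There exist coefficient vectors v : Fin n → (ZMod k_A → ℝ) with v c q = 0 whenever q ∉ T_c, such that for every subset C ⊆ Fin n with |C| = k_A, the k_A × k_A matrix whose rows are (v c)_{c∈C} (columns indexed by ZMod k_A) is invertible. Consequently the scheme of Algorithm 1 is resilient to any s = n − k_A stragglers. -/

import Mathlib

/-- The cyclic interval `{a, a+1, …, a+ω−1}` of length `ω` starting at `a` in `ZMod k`. -/
def Icyc (k ω : ℕ) (a : ZMod k) : Finset (ZMod k) :=
  (Finset.range ω).image (fun j : ℕ => a + (j : ZMod k))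

/-- The support assignment of Algorithm 1: client `i < k_A` gets the cyclic interval of
length `ω_A = s+1` starting at `i`, and passive client `k_A + j` gets the one starting
at `j`. -/
def Tsup (kA s : ℕ) (c : Fin (kA + s)) : Finset (ZMod kA) :=
  if (c : ℕ) < kA then Icyc kA (s + 1) ((c : ℕ) : ZMod kA)
  else Icyc kA (s + 1) (((c : ℕ) - kA : ℕ) : ZMod kA)

theorem mem_Icyc {k ω : ℕ} {a x : ZMod k} :
    x ∈ Icyc k ω a ↔ ∃ j < ω, a + (j : ZMod k) = x := by
  simp [Icyc]

theorem Tsup_eq_Icyc (kA s : ℕ) (c : Fin (kA + s)) :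
    Tsup kA s c = Icyc kA (s + 1) ((c : ℕ) : ZMod kA) := by
  unfold Tsup
  split_ifs with h
  · rfl
  · rw [Nat.cast_sub (not_lt.mp h), ZMod.natCast_self, sub_zero]

/-- A nonempty subset of `ZMod k` closed under adding `1` is everything. -/
theorem ZMod.eq_univ_of_add_one_mem {k : ℕ} [NeZero k] {S : Finset (ZMod k)}
    (hS : S.Nonempty) (h : ∀ x ∈ S, x + 1 ∈ S) : S = Finset.univ := by
  obtain ⟨a, ha⟩ := hS
  have key : ∀ n : ℕ, a + (n : ZMod k) ∈ S := by
    intro n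
    induction n with
    | zero => simpa using ha
    | succ n ih => simpa [add_assoc] using h _ ih
  refine Finset.eq_univ_of_forall fun x => ?_
  simpa using key (x - a).val

/-- Translates of a cyclic interval of length `j + 1` by a nonempty set `D` of starting points
cover at least `min k (|D| + j)` points. -/
theorem min_le_card_biUnion_Icyc {k : ℕ} [NeZero k] {D : Finset (ZMod k)}
    (hD : D.Nonempty) (j : ℕ) :
    min k (D.card + j) ≤ (D.biUnion (Icyc k (j + 1))).card := by
  induction j with
  | zero =>
    refine (min_le_right _ _).trans (Finset.card_le_card fun x hx => ?_)
    exact Finset.mem_biUnion.mpr ⟨x, hx, mem_Icyc.mpr ⟨0, by simp⟩⟩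
  | succ j ih =>
    set S := D.biUnion (Icyc k (j + 1)) with hS
    have hsub : S ⊆ D.biUnion (Icyc k (j + 1 + 1)) := by
      refine Finset.biUnion_mono fun a _ x hx => ?_
      obtain ⟨i, hi, rfl⟩ := mem_Icyc.mp hx
      exact mem_Icyc.mpr ⟨i, by omega, rfl⟩
    have hsucc : ∀ x ∈ S, x + 1 ∈ D.biUnion (Icyc k (j + 1 + 1)) := by
      intro x hx
      obtain ⟨a, ha, hx⟩ := Finset.mem_biUnion.mp hx
      obtain ⟨i, hi, rfl⟩ := mem_Icyc.mp hx
      exact Finset.mem_biUnion.mpr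
        ⟨a, ha, mem_Icyc.mpr ⟨i + 1, by omega, by push_cast; ring⟩⟩
    have hne : S.Nonempty := by
      obtain ⟨a, ha⟩ := hD
      exact ⟨a, Finset.mem_biUnion.mpr ⟨a, ha, mem_Icyc.mpr ⟨0, by simp⟩⟩⟩
    rcases hsub.eq_or_ssubset with heq | hss
    · have huniv := ZMod.eq_univ_of_add_one_mem hne (by rwa [← heq] at hsucc)
      rw [← heq, huniv, Finset.card_univ, ZMod.card]
      exact min_le_left _ _
    · have := Finset.card_lt_card hss
      omega

/-- Each residue is the starting point of at most one active client, so passing to starting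
points loses at most the `s` passive clients. -/
theorem card_le_card_image_cast_add (kA s : ℕ) (A : Finset (Fin (kA + s))) :
    A.card ≤ (A.image fun c : Fin (kA + s) => ((c : ℕ) : ZMod kA)).card + s := by
  rw [← Finset.card_filter_add_card_filter_not (s := A) (fun c : Fin (kA + s) => (c : ℕ) < kA)]
  refine add_le_add ?_ ?_
  · rw [← Finset.card_image_of_injOn (f := fun c : Fin (kA + s) => ((c : ℕ) : ZMod kA))]
    · exact Finset.card_le_card (Finset.image_subset_image (Finset.filter_subset _ _))
    · intro c hc d hd h
      simp only [Finset.coe_filter, Set.mem_ofPred_eq] at hc hd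
      have h' := (ZMod.natCast_eq_natCast_iff' _ _ _).mp h
      rw [Nat.mod_eq_of_lt hc.2, Nat.mod_eq_of_lt hd.2] at h'
      exact Fin.ext h'
  · calc (A.filter fun c : Fin (kA + s) => ¬ (c : ℕ) < kA).card
        ≤ (Finset.Ico kA (kA + s)).card := by
          refine Finset.card_le_card_of_injOn (fun c => (c : ℕ)) ?_ Fin.val_injective.injOn
          intro c hc
          simp only [Finset.coe_filter, Set.mem_ofPred_eq] at hc
          simpa using hc.2
      _ = s := by simp

/-- Hall's condition for the supports of at most `kA` clients. -/
theorem card_le_card_biUnion_Tsup {kA s : ℕ} [NeZero kA] {A : Finset (Fin (kA + s))}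
    (hA : A.card ≤ kA) : A.card ≤ (A.biUnion (Tsup kA s)).card := by
  rcases A.eq_empty_or_nonempty with rfl | hne
  · simp
  have h := min_le_card_biUnion_Icyc (hne.image fun c : Fin (kA + s) => ((c : ℕ) : ZMod kA)) s
  rw [Finset.image_biUnion] at h
  have h2 := card_le_card_image_cast_add kA s A
  simp only [← Tsup_eq_Icyc] at h
  exact (le_min hA h2).trans h

/-- If every `|κ|`-element set of rows has a transversal through the prescribed supports, then
some matrix with these supports has all its maximal square row-submatrices invertible. -/
theorem exists_support_forall_isUnit_det {ι κ R : Type*} [Fintype ι] [DecidableEq ι]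
    [Fintype κ] [DecidableEq κ] [Field R] [Infinite R] (T : ι → Finset κ)
    (f : ∀ C : Finset ι, C.card = Fintype.card κ → ({c // c ∈ C} ≃ κ))
    (hf : ∀ C hC c, f C hC c ∈ T c.1) :
    ∃ v : ι → κ → R, (∀ c q, q ∉ T c → v c q = 0) ∧
      ∀ C hC, IsUnit (Matrix.of fun q q' : κ => v ((f C hC).symm q).1 q').det := by
  let P : ι → κ → MvPolynomial (ι × κ) R :=
    fun c q => if q ∈ T c then MvPolynomial.X (c, q) else 0
  let M : {C : Finset ι // C.card = Fintype.card κ} → Matrix κ κ (MvPolynomial (ι × κ) R) :=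
    fun C => Matrix.of fun q q' => P ((f C.1 C.2).symm q).1 q'
  have hM : ∀ C, (M C).det ≠ 0 := by
    intro C h0
    let x : ι × κ → R := fun p =>
      if h : p.1 ∈ C.1 then if f C.1 C.2 ⟨p.1, h⟩ = p.2 then 1 else 0 else 0
    have h1 : (MvPolynomial.eval x).mapMatrix (M C) = 1 := by
      ext q q'
      have hq := hf C.1 C.2 ((f C.1 C.2).symm q)
      rw [Equiv.apply_symm_apply] at hq
      by_cases hqq : q = q'
      · subst hqq
        simp [M, P, x, hq]
      · by_cases hT : q' ∈ T ((f C.1 C.2).symm q).1 <;> simp [M, P, x, hT, hqq]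
    have h2 := congrArg Matrix.det h1
    rw [← RingHom.map_det, h0] at h2
    simp at h2
  have hprod : (∏ C, (M C).det) ≠ 0 := Finset.prod_ne_zero_iff.mpr fun C _ => hM C
  obtain ⟨x, hx⟩ : ∃ x, MvPolynomial.eval x (∏ C, (M C).det) ≠ 0 := by
    by_contra! h
    exact hprod (MvPolynomial.funext fun x => by simpa using h x)
  refine ⟨fun c q => MvPolynomial.eval x (P c q), fun c q hq => by simp [P, hq],
    fun C hC => ?_⟩
  rw [map_prod, Finset.prod_ne_zero_iff] at hx
  have := hx ⟨C, hC⟩ (Finset.mem_univ _)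
  rw [RingHom.map_det] at this
  exact this.isUnit

/-- Theorem 1 (coefficient form): there exist coefficient vectors supported on the
cyclic-interval support assignment of Algorithm 1 such that for every subset `C` of
`k_A` clients, the `k_A × k_A` matrix whose rows are `(v c)_{c ∈ C}` is invertible
(it has a two-sided inverse); hence the scheme is resilient to any `s = n − k_A`
stragglers. -/
theorem algorithm_one_coefficients (kA s : ℕ) (hs : 1 ≤ s) (hsk : s < kA)
    [NeZero kA] :
    ∃ v : Fin (kA + s) → ZMod kA → ℝ,
      (∀ c q, q ∉ Tsup kA s c → v c q = 0) ∧
      ∀ C : Finset (Fin (kA + s)), C.card = kA →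
        ∃ N : Matrix (ZMod kA) {c // c ∈ C} ℝ,
          (Matrix.of fun (c : {c // c ∈ C}) (q : ZMod kA) => v c.1 q) * N = 1 ∧
          N * (Matrix.of fun (c : {c // c ∈ C}) (q : ZMod kA) => v c.1 q) = 1 := by
  classical
  have hall : ∀ C : Finset (Fin (kA + s)), C.card = Fintype.card (ZMod kA) →
      ∃ f : {c // c ∈ C} ≃ ZMod kA, ∀ c, f c ∈ Tsup kA s c.1 := by
    intro C hC
    obtain ⟨g, hg, hgT⟩ := (Finset.all_card_le_biUnion_card_iff_exists_injective
      fun c : {c // c ∈ C} => Tsup kA s c.1).mp (by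
        intro A
        have hcard : (A.map (Function.Embedding.subtype _)).card ≤ kA := by
          rw [ZMod.card] at hC
          refine le_of_le_of_eq ?_ hC
          refine Finset.card_le_card fun c hc => ?_
          obtain ⟨d, -, rfl⟩ := Finset.mem_map.mp hc
          exact d.2
        simpa [Finset.map_eq_image, Finset.image_biUnion, Finset.card_image_of_injective,
          Subtype.val_injective] using card_le_card_biUnion_Tsup hcard)
    exact ⟨Equiv.ofBijective g ((Fintype.bijective_iff_injective_and_card g).mpr
      ⟨hg, by simpa using hC⟩), hgT⟩
  choose f hf using hall
  obtain ⟨v, hv, hdet⟩ := exists_support_forall_isUnit_det (R := ℝ) (Tsup kA s) f hf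
  refine ⟨v, hv, fun C hC => ?_⟩
  have hC' : C.card = Fintype.card (ZMod kA) := by rw [hC, ZMod.card]
  set e := f C hC'
  set M : Matrix (ZMod kA) (ZMod kA) ℝ := Matrix.of fun q q' => v (e.symm q).1 q' with hMdef
  have hM : IsUnit M.det := hdet C hC'
  have hA : (Matrix.of fun (c : {c // c ∈ C}) (q : ZMod kA) => v c.1 q) = M.submatrix e id := by
    ext c q
    simp [hMdef]
  refine ⟨M⁻¹.submatrix id e, ?_, ?_⟩
  · rw [hA, ← Matrix.submatrix_mul _ _ _ _ _ Function.bijective_id, Matrix.mul_nonsing_inv _ hM]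
    exact Matrix.submatrix_one_equiv e
  · rw [hA, Matrix.submatrix_mul_equiv, Matrix.nonsing_inv_mul _ hM, Matrix.submatrix_id_id]
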